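/- (Laurent–Massart tail bound, as quoted in the proof of Theorem 1.) Let X be a chi-square random variable with n degrees of freedom. Then for every t > 0, P(X ≥ n + 2√(n t) + 2t) ≤ e^{−t}. -/

import Mathlib

open MeasureTheory ProbabilityTheory

/-- On `[c, ∞)`, the gamma density of rate `r` is dominated by a multiple of the gamma density of
any smaller rate `s`. -/
lemma gammaPDF_le_mul_gammaPDF {a r s c x : ℝ} (ha : 0 < a) (hs : 0 < s) (hsr : s ≤ r)
    (hc : 0 ≤ c) (hx : c ≤ x) :
    gammaPDF a r x ≤
      ENNReal.ofReal ((r / s) ^ a * Real.exp (-((r - s) * c))) * gammaPDF a s x := by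
  have hx0 : 0 ≤ x := hc.trans hx
  have hr : 0 < r := hs.trans_le hsr
  rw [gammaPDF_of_nonneg hx0, gammaPDF_of_nonneg hx0, ← ENNReal.ofReal_mul (by positivity)]
  apply ENNReal.ofReal_le_ofReal
  have hsa : 0 < s ^ a := Real.rpow_pos_of_pos hs a
  have hΓ : 0 < Real.Gamma a := Real.Gamma_pos_of_pos ha
  have hexp : Real.exp (-(r * x)) ≤ Real.exp (-((r - s) * c)) * Real.exp (-(s * x)) := by
    rw [← Real.exp_add]
    apply Real.exp_le_exp.mpr
    nlinarith [mul_le_mul_of_nonneg_left hx (sub_nonneg.mpr hsr)]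
  calc r ^ a / Real.Gamma a * x ^ (a - 1) * Real.exp (-(r * x))
      ≤ r ^ a / Real.Gamma a * x ^ (a - 1) *
          (Real.exp (-((r - s) * c)) * Real.exp (-(s * x))) := by gcongr
    _ = _ := by
      rw [Real.div_rpow hr.le hs.le]
      field_simp

/-- Chernoff bound for the upper tail of the gamma distribution. -/
lemma gammaMeasure_Ici_le {a r s c : ℝ} (ha : 0 < a) (hs : 0 < s) (hsr : s ≤ r) (hc : 0 ≤ c) :
    gammaMeasure a r (Set.Ici c) ≤
      ENNReal.ofReal ((r / s) ^ a * Real.exp (-((r - s) * c))) := by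
  rw [gammaMeasure, withDensity_apply _ measurableSet_Ici]
  calc ∫⁻ x in Set.Ici c, gammaPDF a r x
      ≤ ∫⁻ x in Set.Ici c,
          ENNReal.ofReal ((r / s) ^ a * Real.exp (-((r - s) * c))) * gammaPDF a s x :=
        setLIntegral_mono' measurableSet_Ici fun x hx => gammaPDF_le_mul_gammaPDF ha hs hsr hc hx
    _ ≤ ∫⁻ x, ENNReal.ofReal ((r / s) ^ a * Real.exp (-((r - s) * c))) * gammaPDF a s x :=
        setLIntegral_le_lintegral _ _
    _ = _ := by
      rw [lintegral_const_mul' _ _ ENNReal.ofReal_ne_top, lintegral_gammaPDF_eq_one ha hs, mul_one]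

lemma Real.log_le_half_sub_inv {v : ℝ} (hv : 1 ≤ v) : Real.log v ≤ (v - v⁻¹) / 2 := by
  rw [← Real.sinh_log (by linarith)]
  exact Real.self_le_sinh_iff.mpr (Real.log_nonneg hv)

/-- (Laurent–Massart tail bound.) For a chi-square random variable `X` with `n` degrees
of freedom (i.e. Gamma distributed with shape `n/2` and rate `1/2`) and every `t > 0`,
`P(X ≥ n + 2√(nt) + 2t) ≤ e^{−t}`. -/
theorem chiSq_laurent_massart_tail_bound (n : ℕ) (t : ℝ) (ht : 0 < t) :
    gammaMeasure ((n : ℝ) / 2) (1 / 2)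
        (Set.Ici ((n : ℝ) + 2 * Real.sqrt ((n : ℝ) * t) + 2 * t)) ≤
      ENNReal.ofReal (Real.exp (-t)) := by
  rcases Nat.eq_zero_or_pos n with rfl | hn
  · have hpdf : gammaPDF 0 (1 / 2) = 0 := by
      ext x
      simp [gammaPDF_eq]
    rw [Nat.cast_zero, zero_div, gammaMeasure, hpdf]
    simp
  have hn' : (0 : ℝ) < n := Nat.cast_pos.mpr hn
  obtain ⟨m, hm, hmn⟩ : ∃ m : ℝ, 0 < m ∧ m ^ 2 = n :=
    ⟨√n, Real.sqrt_pos.mpr hn', Real.sq_sqrt hn'.le⟩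
  obtain ⟨y, hy, rfl⟩ : ∃ y : ℝ, 0 < y ∧ y ^ 2 = t :=
    ⟨√t, Real.sqrt_pos.mpr ht, Real.sq_sqrt ht.le⟩
  rw [← hmn, ← mul_pow, Real.sqrt_sq (by positivity)]
  -- The optimal Chernoff tilt replaces the rate `1 / 2` by `1 / (2 * v)`.
  set v : ℝ := 1 + 2 * y / m with hv
  have hv1 : 1 ≤ v := by
    rw [hv]
    linarith [show 0 ≤ 2 * y / m by positivity]
  have hv0 : 0 < v := by linarith
  have hle : 1 / (2 * v) ≤ 1 / 2 := one_div_le_one_div_of_le two_pos (by linarith)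
  refine (gammaMeasure_Ici_le (by positivity) (by positivity) hle (by positivity)).trans
    (ENNReal.ofReal_le_ofReal ?_)
  rw [show (1 / 2 : ℝ) / (1 / (2 * v)) = v by field_simp, Real.rpow_def_of_pos hv0, ← Real.exp_add]
  apply Real.exp_le_exp.mpr
  calc Real.log v * (m ^ 2 / 2) + -((1 / 2 - 1 / (2 * v)) * (m ^ 2 + 2 * (m * y) + 2 * y ^ 2))
      ≤ (v - v⁻¹) / 2 * (m ^ 2 / 2) +
          -((1 / 2 - 1 / (2 * v)) * (m ^ 2 + 2 * (m * y) + 2 * y ^ 2)) := by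
        gcongr
        exact Real.log_le_half_sub_inv hv1
    _ = -y ^ 2 := by
      have hv' : v = (m + 2 * y) / m := by
        rw [hv]
        field_simp
      rw [hv']
      field_simp
      ring
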